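/- arXiv:1701.02316 — 2 statements merged into one kernel-verified Lean document; each statement's English description precedes it below -/
import Mathlib

section
/- (Crossing-connected projectors combine) For all m, n ≥ 1 with m + n ≥ 3: (t_m ⊗ t_n) ∘ σ_m ∘ (t_m ⊗ t_n) = t_{m+n} in End(V^{⊗(m+n)}), where σ_m is the swap of the m-th and (m+1)-st tensor factors. -/
open Matrix

noncomputable section

/-- Sign strings `ε ∈ {+,-}^m`; `true` encodes `+` and `false` encodes `-`. -/
abbrev Sgn (m : ℕ) := Fin m → Bool

/-- Endomorphisms of `V^{⊗m}` (`V = ℂ²`), as matrices indexed by sign strings. -/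
abbrev Op (m : ℕ) := Matrix (Sgn m) (Sgn m) ℂ

/-- Linear maps `V^{⊗m} → V^{⊗n}`, as matrices (rows: target, columns: source). -/
abbrev Mor (m n : ℕ) := Matrix (Sgn n) (Sgn m) ℂ

/-- The basis vector `v_ε` of `V^{⊗m}`. -/
def bv {m : ℕ} (ε : Sgn m) : Sgn m → ℂ := fun δ => if δ = ε then 1 else 0

/-- The coefficient of `cap` on `v_a ⊗ v_b`:
`cap (v₋ ⊗ v₊) = 1`, `cap (v₊ ⊗ v₋) = -1`, `cap (v₊ ⊗ v₊) = cap (v₋ ⊗ v₋) = 0`. -/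
def capc (a b : Bool) : ℂ := if a then (if b then 0 else -1) else (if b then 1 else 0)

/-- The coefficient of `v_a ⊗ v_b` in `cup 1 = v₊ ⊗ v₋ - v₋ ⊗ v₊`. -/
def cupc (a b : Bool) : ℂ := if a then (if b then 0 else 1) else (if b then -1 else 0)

/-- The cap `V ⊗ V → ℂ`. -/
def capM : Mor 2 0 := Matrix.of fun _ ε => capc (ε 0) (ε 1)

/-- The cup `ℂ → V ⊗ V`. -/
def cupM : Mor 0 2 := Matrix.of fun δ _ => cupc (δ 0) (δ 1)

/-- The tensor product of two linear maps. -/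
def tensMor {a b c d : ℕ} (A : Mor a b) (B : Mor c d) : Mor (a + c) (b + d) :=
  Matrix.of fun δ ε =>
    A (fun i => δ (Fin.castAdd d i)) (fun i => ε (Fin.castAdd c i)) *
      B (fun j => δ (Fin.natAdd b j)) (fun j => ε (Fin.natAdd a j))

/-- The swap of the two tensor factors of `V ⊗ V`. -/
def swap2 : Op 2 := Matrix.of fun δ ε => if δ 0 = ε 1 ∧ δ 1 = ε 0 then 1 else 0

/-- `id^{⊗p} ⊗ A ⊗ id^{⊗(m-p-2)}`: the operator `A` on two strands placed at the
(0-based) positions `p`, `p+1` among `m` strands. -/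
def atPos (m p : ℕ) (A : Op 2) : Op m :=
  Matrix.of fun δ ε =>
    if h : p + 2 ≤ m then
      (if ∀ k : Fin m, k.val ≠ p → k.val ≠ p + 1 → δ k = ε k then 1 else 0) *
        A (fun i => δ ⟨p + i.val, Nat.lt_of_lt_of_le (Nat.add_lt_add_left i.isLt p) h⟩)
          (fun i => ε ⟨p + i.val, Nat.lt_of_lt_of_le (Nat.add_lt_add_left i.isLt p) h⟩)
    else 0

/-- Cyclic rotation of sign strings: `(rotIdx δ) k = δ (k+1 mod m)`. -/
def rotIdx {m : ℕ} (δ : Sgn m) : Sgn m := fun k => δ ⟨(k.val + 1) % m, Nat.mod_lt _ k.pos⟩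

/-- The rotation `d_m : V^{⊗m} → V^{⊗m}`, `d_m (v_ε ⊗ w) = i^{ε} (w ⊗ v_ε)`. -/
def dRot : (m : ℕ) → Op m
  | 0 => 1
  | (m + 1) =>
    Matrix.of fun δ' δ =>
      if δ' = rotIdx δ then (if δ 0 then Complex.I else -Complex.I) else 0

/-- The cap-cup generator `u_j` (`j` is 1-based, `1 ≤ j ≤ m-1`);
`u_0 := d_m⁻¹ ∘ u_1 ∘ d_m` is the affine generator. -/
def uFull (m j : ℕ) : Op m :=
  if j = 0 then (dRot m)⁻¹ * atPos m 0 (cupM * capM) * dRot m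
  else atPos m (j - 1) (cupM * capM)

/-- The extremal weight projectors `t_m`, defined by `t₁ = id`,
`t₂ = id + u₁/2 + u₀/2`, and `t_{m+1} = (t_m ⊗ id) ∘ σ_m ∘ (t_m ⊗ id)` for `m ≥ 2`
(with the convention `t₀ = 2·id`). -/
def tP : (m : ℕ) → Op m
  | 0 => (2 : ℂ) • 1
  | 1 => 1
  | 2 => 1 + (2⁻¹ : ℂ) • atPos 2 0 (cupM * capM) +
      (2⁻¹ : ℂ) • ((dRot 2)⁻¹ * atPos 2 0 (cupM * capM) * dRot 2)
  | (m + 3) =>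
    tensMor (tP (m + 2)) (1 : Op 1) * atPos (m + 3) (m + 1) swap2 *
      tensMor (tP (m + 2)) (1 : Op 1)

/-- `n` nested caps `Ca_n : V^{⊗2n} → ℂ`. -/
def CaM (n : ℕ) : Mor (n + n) 0 :=
  Matrix.of fun _ δ =>
    ∏ k : Fin n,
      capc (δ ⟨k.val, Nat.lt_of_lt_of_le k.isLt (Nat.le_add_right n n)⟩)
        (δ ⟨n + n - 1 - k.val,
          Nat.lt_of_le_of_lt (Nat.sub_le _ _)
            (Nat.sub_lt (Nat.lt_of_lt_of_le k.pos (Nat.le_add_right n n)) Nat.one_pos)⟩)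

/-- `n` nested cups `Cu_n : ℂ → V^{⊗2n}`. -/
def CuM (n : ℕ) : Mor 0 (n + n) :=
  Matrix.of fun δ _ =>
    ∏ k : Fin n,
      cupc (δ ⟨k.val, Nat.lt_of_lt_of_le k.isLt (Nat.le_add_right n n)⟩)
        (δ ⟨n + n - 1 - k.val,
          Nat.lt_of_le_of_lt (Nat.sub_le _ _)
            (Nat.sub_lt (Nat.lt_of_lt_of_le k.pos (Nat.le_add_right n n)) Nat.one_pos)⟩)

/-- The canonical identification of sign strings induced by an equality of lengths. -/
def sgnCast {a b : ℕ} (h : a = b) : Sgn a ≃ Sgn b :=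
  Equiv.arrowCongr (finCongr h) (Equiv.refl Bool)

/-- Reindexing of a linear map along equalities of the numbers of strands. -/
def rc {a b c d : ℕ} (h1 : a = b) (h2 : c = d) (A : Mor a c) : Mor b d :=
  Matrix.reindex (sgnCast h2) (sgnCast h1) A

/-- The idempotents `e_{m,n}`:
`e_{1,1} = -u₁/2 - d₂⁻¹ ∘ u₁ ∘ d₂ / 2` and
`e_{m,n} = -(t_m ⊗ t_n) ∘ u_m ∘ (t_m ⊗ t_n)` otherwise. -/
def eP : (m n : ℕ) → Op (m + n)
  | 1, 1 =>
    (-(2⁻¹ : ℂ)) • atPos 2 0 (cupM * capM) +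
      (-(2⁻¹ : ℂ)) • ((dRot 2)⁻¹ * atPos 2 0 (cupM * capM) * dRot 2)
  | m, n =>
    -(tensMor (tP m) (tP n) * atPos (m + n) (m - 1) (cupM * capM) * tensMor (tP m) (tP n))

/-- The projector of `V^{⊗m}` onto the span of the `v_ε` with `ε` constant. -/
def constProj (m : ℕ) : Op m := Matrix.diagonal fun ε => if ∀ i j, ε i = ε j then 1 else 0

theorem tensMor_diagonal {a b : ℕ} (f : Sgn a → ℂ) (g : Sgn b → ℂ) :
    (tensMor (Matrix.diagonal f) (Matrix.diagonal g) : Op (a + b)) =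
      Matrix.diagonal fun ε =>
        f (fun i => ε (Fin.castAdd b i)) * g (fun j => ε (Fin.natAdd a j)) := by
  ext δ ε
  by_cases h : δ = ε
  · subst h
    simp [tensMor]
  · rw [Matrix.diagonal_apply_ne _ h]
    simp only [tensMor, Matrix.of_apply, Matrix.diagonal_apply]
    split_ifs with h₁ h₂ <;> try simp
    refine absurd (funext fun k => ?_) h
    induction k using Fin.addCases with
    | left i => exact congrFun h₁ i
    | right j => exact congrFun h₂ j

theorem constProj_one : constProj 1 = 1 := by
  simp [constProj]

theorem constProj_swap_constProj (m n : ℕ) (hm : 1 ≤ m) (hn : 1 ≤ n) (hmn : 3 ≤ m + n) :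
    tensMor (constProj m) (constProj n) * atPos (m + n) (m - 1) swap2 *
      tensMor (constProj m) (constProj n) = constProj (m + n) := by
  have hp : m - 1 + 2 ≤ m + n := by omega
  simp only [constProj, tensMor_diagonal]
  ext δ ε
  rw [Matrix.mul_diagonal, Matrix.diagonal_mul, Matrix.diagonal_apply]
  simp only [atPos, swap2, Matrix.of_apply, dif_pos hp, ← ite_and, mul_ite, mul_one,
    mul_zero]
  refine if_congr ⟨?_, ?_⟩ rfl rfl
  · rintro ⟨⟨hεr, hεl⟩, ⟨⟨h₀, h₁⟩, hoff⟩, hδr, hδl⟩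
    obtain ⟨x, hx⟩ : ∃ x : Fin m, (x : ℕ) = m - 1 := ⟨⟨m - 1, by omega⟩, rfl⟩
    obtain ⟨y, hy⟩ : ∃ y : Fin n, (y : ℕ) = 0 := ⟨⟨0, hn⟩, rfl⟩
    replace h₀ : δ (Fin.castAdd n x) = ε (Fin.natAdd m y) := by
      convert h₀ using 2 <;> ext <;> simp <;> omega
    replace h₁ : δ (Fin.natAdd m y) = ε (Fin.castAdd n x) := by
      convert h₁ using 2 <;> ext <;> simp <;> omega
    have hxy : δ (Fin.castAdd n x) = δ (Fin.natAdd m y) := by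
      rcases (by omega : 2 ≤ m ∨ 2 ≤ n) with h | h
      · have := hoff (Fin.castAdd n ⟨0, hm⟩) (by simp; omega) (by simp)
        rw [hδl x ⟨0, hm⟩, this, hεl ⟨0, hm⟩ x, h₁]
      · have := hoff (Fin.natAdd m ⟨1, h⟩) (by simp; omega) (by simp; omega)
        rw [hδr y ⟨1, h⟩, this, hεr ⟨1, h⟩ y, h₀]
    have hδ (k) : δ k = δ (Fin.castAdd n x) := by
      induction k using Fin.addCases with
      | left i => exact hδl _ _
      | right j => rw [hxy, hδr]
    have hε (k) : ε k = δ (Fin.castAdd n x) := by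
      induction k using Fin.addCases with
      | left i => rw [hxy, h₁, hεl]
      | right j => rw [h₀, hεr]
    exact ⟨funext fun k => (hδ k).trans (hε k).symm, fun i j => (hδ i).trans (hδ j).symm⟩
  · rintro ⟨rfl, hc⟩
    exact ⟨⟨fun _ _ => hc _ _, fun _ _ => hc _ _⟩,
      ⟨⟨hc _ _, hc _ _⟩, fun _ _ _ => rfl⟩, fun _ _ => hc _ _, fun _ _ => hc _ _⟩

theorem sum_sgn_two (f : Sgn 2 → ℂ) :
    ∑ ε, f ε =
      f ![true, true] + f ![true, false] + f ![false, true] + f ![false, false] := by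
  rw [← (finTwoArrowEquiv Bool).symm.sum_comp, Fintype.sum_prod_type]
  simp [add_assoc]

theorem dRot_two_apply (a b c d : Bool) :
    dRot 2 ![a, b] ![c, d] =
      if a = d ∧ b = c then (if c then Complex.I else -Complex.I) else 0 := by
  have h : ![a, b] = rotIdx ![c, d] ↔ a = d ∧ b = c := by decide +revert
  simp only [dRot, Matrix.of_apply]
  exact if_congr h rfl rfl

theorem cup_cap_two_apply (a b c d : Bool) :
    atPos 2 0 (cupM * capM) ![a, b] ![c, d] = cupc a b * capc c d := by
  simp [atPos, cupM, capM, Matrix.mul_apply]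

theorem dRot_two_mul_conjTranspose : dRot 2 * (dRot 2)ᴴ = 1 := by
  ext δ ε
  obtain ⟨⟨a, b⟩, rfl⟩ := (finTwoArrowEquiv Bool).symm.surjective δ
  obtain ⟨⟨c, d⟩, rfl⟩ := (finTwoArrowEquiv Bool).symm.surjective ε
  simp only [finTwoArrowEquiv_symm_apply, Matrix.mul_apply, sum_sgn_two,
    Matrix.conjTranspose_apply, dRot_two_apply, Matrix.one_apply]
  cases a <;> cases b <;> cases c <;> cases d <;> simp

theorem cup_cap_mul_dRot_two :
    atPos 2 0 (cupM * capM) * dRot 2 =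
      dRot 2 * ((-2 : ℂ) • (1 - constProj 2) - atPos 2 0 (cupM * capM)) := by
  ext δ ε
  obtain ⟨⟨a, b⟩, rfl⟩ := (finTwoArrowEquiv Bool).symm.surjective δ
  obtain ⟨⟨c, d⟩, rfl⟩ := (finTwoArrowEquiv Bool).symm.surjective ε
  simp only [finTwoArrowEquiv_symm_apply, Matrix.mul_apply, sum_sgn_two, Matrix.sub_apply,
    Matrix.smul_apply, dRot_two_apply, cup_cap_two_apply, constProj, Matrix.diagonal_apply,
    Matrix.one_apply]
  cases a <;> cases b <;> cases c <;> cases d <;> simp [cupc, capc] <;> ring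

theorem tP_two : tP 2 = constProj 2 := by
  have h : (dRot 2)⁻¹ * dRot 2 = 1 :=
    Matrix.nonsing_inv_mul _ (Matrix.isUnit_det_of_right_inverse dRot_two_mul_conjTranspose)
  rw [tP, Matrix.mul_assoc, cup_cap_mul_dRot_two, ← Matrix.mul_assoc, h, Matrix.one_mul]
  module

theorem tP_eq_constProj : ∀ m : ℕ, 1 ≤ m → tP m = constProj m
  | 1, _ => by rw [constProj_one, tP]
  | 2, _ => tP_two
  | m + 3, _ => by
    rw [tP, tP_eq_constProj (m + 2) (by omega), ← constProj_one]
    exact constProj_swap_constProj (m + 2) 1 (by omega) le_rfl (by omega)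

/-- Crossing-connected projectors combine:
`(t_m ⊗ t_n) ∘ σ_m ∘ (t_m ⊗ t_n) = t_{m+n}` for `m, n ≥ 1`, `m + n ≥ 3`. -/
theorem crossing_connected_projectors (m n : ℕ) (hm : 1 ≤ m) (hn : 1 ≤ n)
    (hmn : 3 ≤ m + n) :
    tensMor (tP m) (tP n) * atPos (m + n) (m - 1) swap2 * tensMor (tP m) (tP n) =
      tP (m + n) := by
  rw [tP_eq_constProj m hm, tP_eq_constProj n hn, tP_eq_constProj (m + n) (by omega)]
  exact constProj_swap_constProj m n hm hn hmn
end
end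

section
/- For all m, n ≥ 1, the idempotent e_{m,n} is the projection onto the two-dimensional subspace span{v₊^{⊗m} ⊗ v₋^{⊗n}, v₋^{⊗m} ⊗ v₊^{⊗n}} of V^{⊗(m+n)}: e_{m,n}(v₊^{⊗m} ⊗ v₋^{⊗n}) = v₊^{⊗m} ⊗ v₋^{⊗n}, e_{m,n}(v₋^{⊗m} ⊗ v₊^{⊗n}) = v₋^{⊗m} ⊗ v₊^{⊗n}, and e_{m,n}(v_ε) = 0 for every other sign string ε ∈ {+,−}^{m+n}. -/
open Matrix

noncomputable section

theorem cupM_mul_capM_apply (δ ε : Sgn 2) :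
    (cupM * capM) δ ε = cupc (δ 0) (δ 1) * capc (ε 0) (ε 1) := by
  simp [Matrix.mul_apply, cupM, capM]

theorem atPos_two_zero (A : Op 2) : atPos 2 0 A = A := by
  ext δ ε
  have h : ∀ k : Fin 2, k.val ≠ 0 → k.val ≠ 0 + 1 → δ k = ε k := by
    intro k h₀ h₁
    have := k.isLt
    omega
  simp only [atPos, Matrix.of_apply]
  rw [dif_pos le_rfl, if_pos h, one_mul]
  congr 1 <;> funext i <;> congr 1 <;> ext <;> simp

theorem dRot_two_inv : (dRot 2)⁻¹ =
    Matrix.of fun δ' δ : Sgn 2 =>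
      if δ' = rotIdx δ then (if δ 1 then -Complex.I else Complex.I) else 0 := by
  have hrot : ∀ δ : Sgn 2, rotIdx (rotIdx δ) = δ := by decide
  have hrot₀ : ∀ δ : Sgn 2, rotIdx δ 0 = δ 1 := by decide
  refine Matrix.inv_eq_right_inv ?_
  ext δ ε
  by_cases h : δ = ε
  · subst h
    cases h₁ : δ 1 <;> simp [dRot, Matrix.mul_apply, hrot, hrot₀, h₁]
  · simp [dRot, Matrix.mul_apply, hrot, h]

theorem dRot_two_conj_apply (A : Op 2) (δ ε : Sgn 2) :
    ((dRot 2)⁻¹ * A * dRot 2) δ ε =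
      (if δ 0 then -Complex.I else Complex.I) * A (rotIdx δ) (rotIdx ε) *
        (if ε 0 then Complex.I else -Complex.I) := by
  have hrot : ∀ δ x : Sgn 2, δ = rotIdx x ↔ x = rotIdx δ := by decide
  have hrot₁ : ∀ δ : Sgn 2, rotIdx δ 1 = δ 0 := by decide
  rw [dRot_two_inv]
  simp [dRot, Matrix.mul_apply, hrot δ, hrot₁]

theorem cupCap_add_conj :
    cupM * capM + (dRot 2)⁻¹ * (cupM * capM) * dRot 2 =
      Matrix.diagonal fun δ : Sgn 2 => if δ 0 = δ 1 then (0 : ℂ) else -2 := by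
  have hrot₀ : ∀ δ : Sgn 2, rotIdx δ 0 = δ 1 := by decide
  have hrot₁ : ∀ δ : Sgn 2, rotIdx δ 1 = δ 0 := by decide
  ext δ ε
  have heq : δ = ε ↔ δ 0 = ε 0 ∧ δ 1 = ε 1 := by
    rw [funext_iff, Fin.forall_fin_two]
  rw [Matrix.add_apply, dRot_two_conj_apply, cupM_mul_capM_apply, cupM_mul_capM_apply,
    Matrix.diagonal_apply, hrot₀, hrot₁, hrot₀, hrot₁]
  simp only [heq]
  cases δ 0 <;> cases δ 1 <;> cases ε 0 <;> cases ε 1 <;> norm_num [cupc, capc]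

open Classical in
/-- The diagonal operator that keeps `v_ε` exactly when `p ε` holds. -/
def coordProj {m : ℕ} (p : Sgn m → Prop) : Op m :=
  Matrix.diagonal fun δ => if p δ then 1 else 0

/-- All signs of the string agree. -/
def IsConst {m : ℕ} (δ : Sgn m) : Prop := ∀ i j, δ i = δ j

theorem coordProj_true {m : ℕ} {p : Sgn m → Prop} (h : ∀ δ, p δ) : coordProj p = 1 := by
  simp [coordProj, h]

theorem coordProj_mulVec_bv {m : ℕ} {p : Sgn m → Prop} {ε : Sgn m} (h : p ε) :
    (coordProj p).mulVec (bv ε) = bv ε := by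
  ext δ
  rw [coordProj, Matrix.mulVec_diagonal]
  by_cases hδ : δ = ε <;> simp [bv, hδ, h]

theorem coordProj_mulVec_bv_eq_zero {m : ℕ} {p : Sgn m → Prop} {ε : Sgn m} (h : ¬ p ε) :
    (coordProj p).mulVec (bv ε) = 0 := by
  ext δ
  rw [coordProj, Matrix.mulVec_diagonal]
  by_cases hδ : δ = ε <;> simp [bv, hδ, h]

theorem tensMor_coordProj {a b : ℕ} (p : Sgn a → Prop) (q : Sgn b → Prop) :
    tensMor (coordProj p) (coordProj q) =
      coordProj fun δ : Sgn (a + b) =>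
        p (fun i => δ (Fin.castAdd b i)) ∧ q (fun j => δ (Fin.natAdd a j)) := by
  ext δ ε
  have heq : δ = ε ↔ (fun i => δ (Fin.castAdd b i)) = (fun i => ε (Fin.castAdd b i)) ∧
      (fun j => δ (Fin.natAdd a j)) = (fun j => ε (Fin.natAdd a j)) := by
    simp only [funext_iff]
    exact Fin.forall_fin_add fun k => δ k = ε k
  simp only [tensMor, coordProj, Matrix.of_apply, Matrix.diagonal_apply, heq]
  split_ifs <;> simp_all

open Classical in
theorem coordProj_mul_mul_coordProj_apply {m : ℕ} (p : Sgn m → Prop) (A : Op m)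
    (δ ε : Sgn m) :
    (coordProj p * A * coordProj p) δ ε = if p δ ∧ p ε then A δ ε else 0 := by
  rw [coordProj, Matrix.mul_diagonal, Matrix.diagonal_mul]
  split_ifs <;> simp_all

theorem isConst_sgn_one (δ : Sgn 1) : IsConst δ := fun i j =>
  congrArg δ (Subsingleton.elim i j)

open Classical in
theorem tP_succ (m : ℕ) : tP (m + 1) = coordProj IsConst := by
  match m with
  | 0 => exact (coordProj_true isConst_sgn_one).symm
  | 1 =>
    rw [tP, atPos_two_zero, add_assoc, ← smul_add, cupCap_add_conj]
    ext δ ε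
    have hconst : IsConst δ ↔ δ 0 = δ 1 := by
      simp [IsConst, Fin.forall_fin_two, eq_comm]
    simp only [coordProj, Matrix.add_apply, Matrix.smul_apply, Matrix.diagonal_apply,
      Matrix.one_apply, hconst]
    split_ifs <;> norm_num
  | m + 2 =>
    rw [tP, tP_succ (m + 1), ← coordProj_true isConst_sgn_one, tensMor_coordProj]
    ext δ ε
    rw [coordProj_mul_mul_coordProj_apply, coordProj, Matrix.diagonal_apply, atPos,
      Matrix.of_apply, dif_pos le_rfl, swap2, Matrix.of_apply]
    by_cases h : δ = ε ∧ IsConst δ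
    · obtain ⟨rfl, hδ⟩ := h
      have hp : IsConst (fun i => δ (Fin.castAdd 1 i)) := fun i j => hδ _ _
      rw [if_pos ⟨⟨hp, isConst_sgn_one _⟩, hp, isConst_sgn_one _⟩, if_pos (fun _ _ _ => rfl),
        if_pos ⟨hδ _ _, hδ _ _⟩, if_pos rfl, if_pos hδ, mul_one]
    · have hR : (if δ = ε then if IsConst δ then (1 : ℂ) else 0 else 0) = 0 := by
        split_ifs with h₁ h₂
        exacts [absurd ⟨h₁, h₂⟩ h, rfl, rfl]
      rw [hR]
      split_ifs with hc hout hsw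
      · refine absurd ?_ h
        obtain ⟨⟨hδ, -⟩, hε, -⟩ := hc
        have hδ' : ∀ k (hk : k < m + 2), δ ⟨k, by omega⟩ = δ ⟨0, by omega⟩ :=
          fun k hk => hδ ⟨k, hk⟩ ⟨0, by omega⟩
        have hε' : ∀ k (hk : k < m + 2), ε ⟨k, by omega⟩ = ε ⟨0, by omega⟩ :=
          fun k hk => hε ⟨k, hk⟩ ⟨0, by omega⟩
        have h₀ : δ ⟨0, by omega⟩ = ε ⟨0, by omega⟩ :=
          hout _ (Nat.succ_ne_zero m).symm (Nat.succ_ne_zero _).symm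
        have h₁ : δ ⟨m + 1, by omega⟩ = ε ⟨m + 2, by omega⟩ := hsw.1
        have h₂ : δ ⟨m + 2, by omega⟩ = ε ⟨m + 1, by omega⟩ := hsw.2
        have hδ₀ : ∀ k, δ k = δ ⟨0, by omega⟩ := by
          rintro ⟨k, hk⟩
          obtain hk' | rfl : k < m + 2 ∨ k = m + 2 := by omega
          · exact hδ' k hk'
          · rw [h₂, hε' _ (by omega), h₀]
        have hε₀ : ∀ k, ε k = δ ⟨0, by omega⟩ := by
          rintro ⟨k, hk⟩
          obtain hk' | rfl : k < m + 2 ∨ k = m + 2 := by omega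
          · rw [hε' k hk', h₀]
          · rw [← h₁, hδ' _ (by omega)]
        exact ⟨funext fun k => (hδ₀ k).trans (hε₀ k).symm,
          fun i j => (hδ₀ i).trans (hδ₀ j).symm⟩
      all_goals simp

theorem eP_one_one : eP 1 1 = coordProj fun ε : Sgn 2 =>
    ε = (fun k => decide (k.val < 1)) ∨ ε = (fun k => decide (1 ≤ k.val)) := by
  rw [eP, atPos_two_zero, ← smul_add, cupCap_add_conj]
  ext δ ε
  have hp : δ 0 = δ 1 ↔
      ¬ (δ = (fun k => decide (k.val < 1)) ∨ δ = (fun k => decide (1 ≤ k.val))) := by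
    revert δ
    decide
  simp only [coordProj, Matrix.smul_apply, Matrix.diagonal_apply, hp]
  split_ifs <;> norm_num at *

theorem eP_of_ne (m n : ℕ) (h : m ≠ 1 ∨ n ≠ 1) : eP m n =
    -(tensMor (tP m) (tP n) * atPos (m + n) (m - 1) (cupM * capM) *
      tensMor (tP m) (tP n)) := by
  rw [eP]
  rintro rfl rfl
  simp at h

theorem capc_self (a : Bool) : capc a a = 0 := by cases a <;> rfl

theorem cupc_self (a : Bool) : cupc a a = 0 := by cases a <;> rfl

theorem cupc_mul_capc_of_ne {a b : Bool} (h : a ≠ b) : cupc a b * capc a b = -1 := by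
  cases a <;> cases b <;> simp_all [cupc, capc]

theorem eP_eq_coordProj (m n : ℕ) (hm : 1 ≤ m) (hn : 1 ≤ n) :
    eP m n = coordProj fun ε =>
      ε = (fun k => decide (k.val < m)) ∨ ε = (fun k => decide (m ≤ k.val)) := by
  by_cases hmn : m = 1 ∧ n = 1
  · obtain ⟨rfl, rfl⟩ := hmn
    exact eP_one_one
  obtain ⟨m, rfl⟩ : ∃ k, m = k + 1 := ⟨m - 1, by omega⟩
  obtain ⟨n, rfl⟩ : ∃ k, n = k + 1 := ⟨n - 1, by omega⟩
  rw [eP_of_ne _ _ (by omega), tP_succ, tP_succ, tensMor_coordProj]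
  ext δ ε
  rw [Matrix.neg_apply, coordProj_mul_mul_coordProj_apply, coordProj, Matrix.diagonal_apply,
    atPos, Matrix.of_apply, dif_pos (by omega), cupM_mul_capM_apply]
  simp only [Nat.add_sub_cancel, Fin.val_zero, Fin.val_one, add_zero]
  have blocks : ∀ γ : Sgn (m + 1 + (n + 1)),
      IsConst (fun i => γ (Fin.castAdd (n + 1) i)) ∧
        IsConst (fun j => γ (Fin.natAdd (m + 1) j)) ↔
      ∀ k, γ k = if k.val < m + 1 then γ ⟨m, by omega⟩ else γ ⟨m + 1, by omega⟩ := by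
    intro γ
    constructor
    · rintro ⟨hl, hr⟩ k
      refine Fin.addCases (fun i => ?_) (fun j => ?_) k
      · rw [if_pos (by simp [i.isLt])]
        exact hl i (Fin.last m)
      · rw [if_neg (by simp; omega)]
        exact hr j 0
    · intro h
      refine ⟨fun i j => ?_, fun i j => ?_⟩
      · change γ _ = γ _
        rw [h (Fin.castAdd (n + 1) i), h (Fin.castAdd (n + 1) j), if_pos (by simp [i.isLt]),
          if_pos (by simp [j.isLt])]
      · change γ _ = γ _
        rw [h (Fin.natAdd (m + 1) i), h (Fin.natAdd (m + 1) j), if_neg (by simp; omega),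
          if_neg (by simp; omega)]
  simp only [blocks]
  have hq : (δ = (fun k => decide (k.val < m + 1)) ∨ δ = (fun k => decide (m + 1 ≤ k.val))) ↔
      (∀ k, δ k = if k.val < m + 1 then δ ⟨m, by omega⟩ else δ ⟨m + 1, by omega⟩) ∧
        δ ⟨m, by omega⟩ ≠ δ ⟨m + 1, by omega⟩ := by
    constructor
    · rintro (h | h) <;> subst h <;> simp
      grind
    · rintro ⟨h, hne⟩
      cases h₀ : δ ⟨m, by omega⟩ <;> cases h₁ : δ ⟨m + 1, by omega⟩ <;>
        simp only [h₀, h₁, ne_eq, not_true_eq_false] at hne h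
      · right
        funext k
        rw [h k]
        split_ifs <;> simp <;> omega
      · left
        funext k
        rw [h k]
        split_ifs <;> simp <;> omega
  simp only [hq]
  by_cases heq : δ = ε
  · subst heq
    by_cases hne : δ ⟨m, by omega⟩ = δ ⟨m + 1, by omega⟩
    · simp [hne, capc_self]
    · simp only [hne, cupc_mul_capc_of_ne hne, ne_eq, not_false_eq_true, and_true, and_self,
        implies_true, if_true, one_mul]
      split_ifs <;> simp
  · rw [if_neg heq, neg_eq_zero]
    split_ifs with hb hout
    · obtain ⟨hδ, hε⟩ := hb
      by_contra hnz
      have hδne : δ ⟨m, by omega⟩ ≠ δ ⟨m + 1, by omega⟩ := fun h => hnz (by simp [h, cupc_self])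
      have hεne : ε ⟨m, by omega⟩ ≠ ε ⟨m + 1, by omega⟩ := fun h => hnz (by simp [h, capc_self])
      have hagree : δ ⟨m, by omega⟩ = ε ⟨m, by omega⟩ ∨
          δ ⟨m + 1, by omega⟩ = ε ⟨m + 1, by omega⟩ := by
        obtain hm' | hn' : m ≠ 0 ∨ n ≠ 0 := by omega
        · left
          have h₀ := hout ⟨0, by omega⟩ (Ne.symm hm') (by simp)
          rw [hδ, hε] at h₀
          simpa using h₀
        · right
          have h₀ := hout ⟨m + 2, by omega⟩ (by simp) (by simp)
          rw [hδ, hε] at h₀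
          simpa using h₀
      have hboth : δ ⟨m, by omega⟩ = ε ⟨m, by omega⟩ ∧
          δ ⟨m + 1, by omega⟩ = ε ⟨m + 1, by omega⟩ := by
        revert hδne hεne hagree
        generalize δ ⟨m, _⟩ = a, δ ⟨m + 1, _⟩ = b, ε ⟨m, _⟩ = c, ε ⟨m + 1, _⟩ = d
        revert a b c d
        decide
      exact heq (funext fun k => by rw [hδ k, hε k, hboth.1, hboth.2])
    all_goals simp

/-- `e_{m,n}` is the projection onto
`span{v₊^{⊗m} ⊗ v₋^{⊗n}, v₋^{⊗m} ⊗ v₊^{⊗n}}`. -/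
theorem eP_is_projection (m n : ℕ) (hm : 1 ≤ m) (hn : 1 ≤ n) :
    (eP m n).mulVec (bv (fun k : Fin (m + n) => decide (k.val < m))) =
      bv (fun k : Fin (m + n) => decide (k.val < m)) ∧
    (eP m n).mulVec (bv (fun k : Fin (m + n) => decide (m ≤ k.val))) =
      bv (fun k : Fin (m + n) => decide (m ≤ k.val)) ∧
    ∀ ε : Sgn (m + n),
      ε ≠ (fun k => decide (k.val < m)) → ε ≠ (fun k => decide (m ≤ k.val)) →
      (eP m n).mulVec (bv ε) = 0 := by
  rw [eP_eq_coordProj m n hm hn]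
  exact ⟨coordProj_mulVec_bv (Or.inl rfl), coordProj_mulVec_bv (Or.inr rfl),
    fun ε h₁ h₂ => coordProj_mulVec_bv_eq_zero (not_or.mpr ⟨h₁, h₂⟩)⟩
end
end
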